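/- arXiv:1502.05248 — 2 statements merged into one kernel-verified Lean document; each statement's English description precedes it below -/
import Mathlib

section
/- Let 0 < a < b < 1/2 with d_a + d_b > 1, and let μ = μ_a × μ_b on ℝ². Then the 1-energy of μ is finite: ∬ |z − w|^{−1} dμ(z) dμ(w) < ∞. -/
open MeasureTheory Filter Metric Set Topology
open scoped ENNReal Topology

noncomputable section

/-- `ℝⁿ` as a Euclidean space. -/
abbrev Euc (n : ℕ) : Type := EuclideanSpace ℝ (Fin n)

/-- The identification of `ℝ × ℝ` with the Euclidean plane `ℝ²`. -/
def emb (p : ℝ × ℝ) : Euc 2 := (WithLp.equiv 2 (Fin 2 → ℝ)).symm ![p.1, p.2]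

/-- `d_ρ = log 2 / log (1/ρ)`, the Hausdorff dimension of the self-similar set `C_ρ`. -/
def dd (ρ : ℝ) : ℝ := Real.log 2 / Real.log (1 / ρ)

theorem dd_pos {a : ℝ} (ha : 0 < a) (ha' : a < 1 / 2) : 0 < dd a := by
  refine div_pos (Real.log_pos one_lt_two) (Real.log_pos ?_)
  rw [lt_div_iff₀ ha]
  linarith

theorem rpow_dd {a : ℝ} (ha : 0 < a) (ha' : a < 1 / 2) : a ^ dd a = 1 / 2 := by
  have hlog : Real.log a < 0 := Real.log_neg ha (by linarith)
  rw [Real.rpow_def_of_pos ha, dd, one_div, Real.log_inv]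
  have h : Real.log a * (Real.log 2 / -Real.log a) = -Real.log 2 := by
    field_simp [hlog.ne]
  rw [h, Real.exp_neg, Real.exp_log two_pos, one_div]

/-- A nonempty compact set invariant under the two contractions lies in `[0, 1]`. -/
theorem attractor_subset_Icc {a : ℝ} (ha : 0 < a) (ha' : a < 1 / 2) {C : Set ℝ}
    (hC : IsCompact C) (hne : C.Nonempty)
    (hattr : C = (fun t => a * t) '' C ∪ (fun t => a * t + 1 - a) '' C) :
    C ⊆ Icc 0 1 := by
  obtain ⟨m, hmC, hm⟩ := hC.exists_isLeast hne
  obtain ⟨M, hMC, hM⟩ := hC.exists_isGreatest hne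
  have hm0 : 0 ≤ m := by
    rw [hattr] at hmC
    rcases hmC with ⟨t, ht, rfl⟩ | ⟨t, ht, rfl⟩ <;> have := hm ht <;> simp only at this ⊢ <;>
      nlinarith
  have hM1 : M ≤ 1 := by
    rw [hattr] at hMC
    rcases hMC with ⟨t, ht, rfl⟩ | ⟨t, ht, rfl⟩ <;> have := hM ht <;> simp only at this ⊢ <;>
      nlinarith
  exact fun t ht => ⟨hm0.trans (hm ht), (hM ht).trans hM1⟩

/-- Transfer of normalised Hausdorff measure through an affine contraction of ratio `a`. -/
theorem measure_Icc_le_half {a : ℝ} (ha : 0 < a) (ha' : a < 1 / 2) {C : Set ℝ} {ν : Measure ℝ}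
    (hν : ν = (μH[dd a] C)⁻¹ • μH[dd a].restrict C) {x y c : ℝ}
    (hsub : Icc x y ∩ C ⊆ (fun t => a * t + c) '' C) :
    ν (Icc x y) ≤ 2⁻¹ * ν (Icc ((x - c) / a) ((y - c) / a)) := by
  have hlip : LipschitzWith a.toNNReal (fun t : ℝ => a * t + c) := by
    refine LipschitzWith.of_dist_le_mul fun s t => le_of_eq ?_
    simp only [Real.dist_eq, Real.coe_toNNReal a ha.le]
    rw [show a * s + c - (a * t + c) = a * (s - t) by ring, abs_mul, abs_of_pos ha]
  have hsub' : Icc x y ∩ C ⊆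
      (fun t => a * t + c) '' (Icc ((x - c) / a) ((y - c) / a) ∩ C) := by
    intro u hu
    obtain ⟨t, ht, rfl⟩ := hsub hu
    refine ⟨t, ⟨⟨?_, ?_⟩, ht⟩, rfl⟩
    · rw [div_le_iff₀ ha]; have := hu.1.1; simp only at this; linarith
    · rw [le_div_iff₀ ha]; have := hu.1.2; simp only at this; linarith
  have hpow : (a.toNNReal : ℝ≥0∞) ^ dd a = 2⁻¹ := by
    change ENNReal.ofReal a ^ dd a = 2⁻¹
    rw [ENNReal.ofReal_rpow_of_pos ha, rpow_dd ha ha', one_div,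
      ENNReal.ofReal_inv_of_pos two_pos, ENNReal.ofReal_ofNat]
  have key : μH[dd a] (Icc x y ∩ C) ≤
      2⁻¹ * μH[dd a] (Icc ((x - c) / a) ((y - c) / a) ∩ C) := by
    rw [← hpow]
    exact (measure_mono hsub').trans (hlip.hausdorffMeasure_image_le (dd_pos ha ha').le _)
  rw [hν, Measure.smul_apply, Measure.smul_apply, Measure.restrict_apply measurableSet_Icc,
    Measure.restrict_apply measurableSet_Icc, smul_eq_mul, smul_eq_mul, mul_left_comm]
  gcongr

theorem measure_Icc_le_pow {a : ℝ} (ha : 0 < a) (ha' : a < 1 / 2) {C : Set ℝ}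
    (hC : IsCompact C) (hne : C.Nonempty)
    (hattr : C = (fun t => a * t) '' C ∪ (fun t => a * t + 1 - a) '' C)
    {ν : Measure ℝ} [IsProbabilityMeasure ν]
    (hν : ν = (μH[dd a] C)⁻¹ • μH[dd a].restrict C) (n : ℕ) (x y : ℝ)
    (hxy : y - x < (1 - 2 * a) * a ^ n) : ν (Icc x y) ≤ 2⁻¹ ^ n := by
  have hsub := attractor_subset_Icc ha ha' hC hne hattr
  induction n generalizing x y with
  | zero => simpa using prob_le_one
  | succ n ih =>
    have hlen (c : ℝ) : (y - c) / a - (x - c) / a < (1 - 2 * a) * a ^ n := by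
      rw [← sub_div, div_lt_iff₀ ha, mul_assoc, ← pow_succ]
      linarith
    have hgap : y - x < 1 - 2 * a := by
      refine hxy.trans_le (mul_le_of_le_one_right (by linarith) ?_)
      exact pow_le_one₀ ha.le (by linarith)
    have step (c : ℝ) (h : Icc x y ∩ C ⊆ (fun t => a * t + c) '' C) :
        ν (Icc x y) ≤ 2⁻¹ ^ (n + 1) := by
      rw [pow_succ']
      refine (measure_Icc_le_half ha ha' hν h).trans ?_
      gcongr
      exact ih _ _ (hlen c)
    by_cases hx : x ≤ a
    · refine step 0 fun u hu => ?_
      have huC := hu.2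
      rw [hattr] at huC
      rcases huC with ⟨t, ht, rfl⟩ | ⟨t, ht, rfl⟩
      · exact ⟨t, ht, by simp⟩
      · exfalso
        have h1 := hu.1.2
        have h2 := (hsub ht).1
        simp only at h1
        nlinarith
    · refine step (1 - a) fun u hu => ?_
      have huC := hu.2
      rw [hattr] at huC
      rcases huC with ⟨t, ht, rfl⟩ | ⟨t, ht, rfl⟩
      · exfalso
        have h1 := hu.1.1
        have h2 := (hsub ht).2
        simp only at h1
        nlinarith
      · exact ⟨t, ht, by linarith⟩

/-- Frostman bound: normalised Hausdorff measure on the Cantor set `C_a` is upper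
`dd a`-regular. -/
theorem exists_measure_Icc_le_rpow {a : ℝ} (ha : 0 < a) (ha' : a < 1 / 2) {C : Set ℝ}
    (hC : IsCompact C) (hne : C.Nonempty)
    (hattr : C = (fun t => a * t) '' C ∪ (fun t => a * t + 1 - a) '' C)
    {ν : Measure ℝ} [IsProbabilityMeasure ν]
    (hν : ν = (μH[dd a] C)⁻¹ • μH[dd a].restrict C) :
    ∃ K : ℝ, 0 ≤ K ∧ ∀ x y, x < y → ν (Icc x y) ≤ ENNReal.ofReal (K * (y - x) ^ dd a) := by
  have hd := dd_pos ha ha'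
  set g : ℝ := (1 - 2 * a) / 2 with hg_def
  have hg : 0 < g := by linarith
  have hk0 : 0 < g * a := by positivity
  refine ⟨((g * a) ^ dd a)⁻¹, by positivity, fun x y hxy => ?_⟩
  have hL : 0 < y - x := sub_pos.2 hxy
  rw [← div_eq_inv_mul]
  rcases le_or_gt g (y - x) with h | h
  · refine prob_le_one.trans ?_
    rw [ENNReal.one_le_ofReal, one_le_div (by positivity)]
    exact Real.rpow_le_rpow hk0.le (by nlinarith) hd.le
  · obtain ⟨n, hn1, hn2⟩ := exists_nat_pow_near_of_lt_one
      (div_pos hL hg) ((div_le_one hg).2 h.le) ha (by linarith : a < 1)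
    rw [lt_div_iff₀ hg] at hn1
    rw [div_le_iff₀ hg] at hn2
    have hlt : y - x < (1 - 2 * a) * a ^ n := by
      have : 0 < a ^ n * g := by positivity
      rw [show 1 - 2 * a = 2 * g by rw [hg_def]; ring]
      linarith
    refine (measure_Icc_le_pow ha ha' hC hne hattr hν n x y hlt).trans ?_
    have h2 : (2⁻¹ : ℝ≥0∞) ^ n = ENNReal.ofReal ((1 / 2) ^ n) := by
      rw [ENNReal.ofReal_pow (by norm_num), one_div, ENNReal.ofReal_inv_of_pos two_pos,
        ENNReal.ofReal_ofNat]
    rw [h2]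
    refine ENNReal.ofReal_le_ofReal ((le_div_iff₀ (by positivity)).2 ?_)
    have h3 : ((1 : ℝ) / 2) ^ n = (a ^ n) ^ dd a := by
      rw [← rpow_dd ha ha', ← Real.rpow_natCast, ← Real.rpow_natCast, ← Real.rpow_mul ha.le,
        ← Real.rpow_mul ha.le, mul_comm]
    rw [h3, ← Real.mul_rpow (by positivity) hk0.le]
    refine Real.rpow_le_rpow (by positivity) ?_ hd.le
    rw [pow_succ] at hn1
    linarith

/-- A measure on a metric space that is uniformly upper `s`-regular with `s > 1` has finite
`1`-energy. -/
theorem lintegral_lintegral_inv_edist_lt_top {X : Type*} [PseudoMetricSpace X] [MeasurableSpace X]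
    [OpensMeasurableSpace X] (μ : Measure X) [IsProbabilityMeasure μ] {s K : ℝ} (hs : 1 < s)
    (hK : 0 ≤ K)
    (h : ∀ z r, 0 < r → μ (closedBall z r) ≤ ENNReal.ofReal (K * r ^ s)) :
    ∫⁻ z, ∫⁻ w, (edist z w)⁻¹ ∂μ ∂μ < ⊤ := by
  set q : ℝ := (1 / 2) ^ (s - 1) with hq
  have hq0 : 0 ≤ q := by positivity
  have hq1 : q < 1 := Real.rpow_lt_one (by norm_num) (by norm_num) (by linarith)
  have hpt (z w : X) : (edist z w)⁻¹ ≤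
      1 + ∑' n : ℕ, (closedBall z ((1 / 2 : ℝ) ^ n)).indicator (fun _ => (2 : ℝ≥0∞) ^ (n + 1)) w := by
    rw [edist_dist]
    rcases lt_or_ge 1 (dist z w) with h1 | h1
    · refine le_add_right (ENNReal.inv_le_one.2 (ENNReal.one_le_ofReal.2 h1.le))
    refine le_add_left ?_
    rcases (dist_nonneg (x := z) (y := w)).eq_or_lt' with h0 | h0
    · have hmem (n : ℕ) : w ∈ closedBall z ((1 / 2 : ℝ) ^ n) := by
        rw [mem_closedBall', h0]; positivity
      simp only [indicator_of_mem (hmem _)]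
      refine le_top.trans_eq (Eq.symm (top_unique ?_))
      rw [← ENNReal.tsum_const_eq_top_of_ne_zero (α := ℕ) one_ne_zero]
      exact ENNReal.tsum_le_tsum fun n => one_le_pow₀ one_le_two
    · obtain ⟨n, hn1, hn2⟩ := exists_nat_pow_near_of_lt_one h0 h1
        (by norm_num : (0 : ℝ) < 1 / 2) (by norm_num)
      refine le_trans ?_ (ENNReal.le_tsum n)
      rw [indicator_of_mem (mem_closedBall'.2 hn2), ← ENNReal.ofReal_inv_of_pos h0,
        ← ENNReal.ofReal_ofNat 2, ← ENNReal.ofReal_pow two_pos.le]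
      refine ENNReal.ofReal_le_ofReal ((inv_le_comm₀ h0 (by positivity)).2 ?_)
      rw [← inv_pow, ← one_div]
      exact hn1.le
  have hterm (z : X) (n : ℕ) :
      ∫⁻ w, (closedBall z ((1 / 2 : ℝ) ^ n)).indicator (fun _ => (2 : ℝ≥0∞) ^ (n + 1)) w ∂μ ≤
        ENNReal.ofReal (2 * K * q ^ n) := by
    rw [lintegral_indicator_const isClosed_closedBall.measurableSet]
    calc (2 : ℝ≥0∞) ^ (n + 1) * μ (closedBall z ((1 / 2 : ℝ) ^ n))
        ≤ ENNReal.ofReal (2 ^ (n + 1)) * ENNReal.ofReal (K * ((1 / 2 : ℝ) ^ n) ^ s) := by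
          rw [ENNReal.ofReal_pow two_pos.le, ENNReal.ofReal_ofNat]
          gcongr
          exact h _ _ (by positivity)
      _ = _ := by
          rw [← ENNReal.ofReal_mul (by positivity)]
          congr 1
          have h1 : ((1 / 2 : ℝ) ^ n) ^ s = (1 / 2) ^ n * q ^ n := by
            rw [hq, ← mul_pow, ← Real.rpow_natCast, ← Real.rpow_natCast, ← Real.rpow_mul (by norm_num),
              mul_comm (n : ℝ) s, Real.rpow_mul (by norm_num), Real.rpow_sub_one (by norm_num)]
            congr 1
            field_simp
          rw [h1, pow_succ]
          have h2 : (2 : ℝ) ^ n * (1 / 2) ^ n = 1 := by rw [← mul_pow]; norm_num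
          linear_combination (2 * K * q ^ n) * h2
  have hsum : Summable fun n : ℕ => 2 * K * q ^ n :=
    (summable_geometric_of_lt_one hq0 hq1).mul_left _
  calc ∫⁻ z, ∫⁻ w, (edist z w)⁻¹ ∂μ ∂μ
      ≤ ∫⁻ _, (1 + ∑' n : ℕ, ENNReal.ofReal (2 * K * q ^ n)) ∂μ := by
        refine lintegral_mono fun z => ?_
        refine (lintegral_mono (hpt z)).trans ?_
        rw [lintegral_add_left measurable_const, lintegral_const, measure_univ, one_mul,
          lintegral_tsum fun n =>
            (measurable_const.indicator isClosed_closedBall.measurableSet).aemeasurable]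
        gcongr with n
        exact hterm z n
    _ < ⊤ := by
        rw [lintegral_const, measure_univ, mul_one, ENNReal.add_lt_top]
        refine ⟨ENNReal.one_lt_top, ?_⟩
        rw [← ENNReal.ofReal_tsum_of_nonneg (fun n => by positivity) hsum]
        exact ENNReal.ofReal_lt_top

theorem measurable_emb : Measurable emb := by
  have : emb = fun p : ℝ × ℝ => WithLp.toLp 2 ![p.1, p.2] := rfl
  rw [this]
  refine (WithLp.measurable_toLp 2 (Fin 2 → ℝ)).comp (measurable_pi_iff.2 fun i => ?_)
  fin_cases i
  · exact measurable_fst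
  · exact measurable_snd

theorem emb_preimage_closedBall_subset (z : Euc 2) (r : ℝ) :
    emb ⁻¹' closedBall z r ⊆ Icc (z 0 - r) (z 0 + r) ×ˢ Icc (z 1 - r) (z 1 + r) := by
  intro p hp
  have hp' : ‖emb p - z‖ ≤ r := by simpa [dist_eq_norm] using hp
  have h0 : |p.1 - z 0| ≤ r := (PiLp.norm_apply_le (emb p - z) 0).trans hp'
  have h1 : |p.2 - z 1| ≤ r := (PiLp.norm_apply_le (emb p - z) 1).trans hp'
  rw [abs_le] at h0 h1
  refine ⟨⟨?_, ?_⟩, ?_, ?_⟩ <;> linarith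

theorem statement13
    (a b : ℝ) (ha : 0 < a) (hab : a < b) (hb : b < 1 / 2)
    (Ca Cb : Set ℝ)
    (hCacomp : IsCompact Ca) (hCane : Ca.Nonempty)
    (hCaattr : Ca = (fun t => a * t) '' Ca ∪ (fun t => a * t + 1 - a) '' Ca)
    (hCbcomp : IsCompact Cb) (hCbne : Cb.Nonempty)
    (hCbattr : Cb = (fun t => b * t) '' Cb ∪ (fun t => b * t + 1 - b) '' Cb)
    (μa μb : Measure ℝ) [IsProbabilityMeasure μa] [IsProbabilityMeasure μb]
    (hμa : μa = (μH[dd a] Ca)⁻¹ • μH[dd a].restrict Ca)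
    (hμb : μb = (μH[dd b] Cb)⁻¹ • μH[dd b].restrict Cb)
    (hd : 1 < dd a + dd b)
    (μ : Measure (Euc 2)) [IsProbabilityMeasure μ]
    (hμ : μ = Measure.map emb (μa.prod μb)) :
    ∫⁻ z, ∫⁻ w, (edist z w)⁻¹ ∂μ ∂μ < ⊤ := by
  obtain ⟨K, hK, hFa⟩ :=
    exists_measure_Icc_le_rpow ha (hab.trans hb) hCacomp hCane hCaattr hμa
  obtain ⟨L, hL, hFb⟩ :=
    exists_measure_Icc_le_rpow (ha.trans hab) hb hCbcomp hCbne hCbattr hμb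
  refine lintegral_lintegral_inv_edist_lt_top μ hd
    (K := K * L * 2 ^ (dd a + dd b)) (by positivity) fun z r hr => ?_
  rw [hμ, Measure.map_apply measurable_emb isClosed_closedBall.measurableSet]
  refine (measure_mono (emb_preimage_closedBall_subset z r)).trans ?_
  rw [Measure.prod_prod]
  refine (mul_le_mul' (hFa _ _ (by linarith)) (hFb _ _ (by linarith))).trans_eq ?_
  have h (t : ℝ) : t + r - (t - r) = 2 * r := by ring
  rw [h, h, ← ENNReal.ofReal_mul (by positivity), mul_assoc (K * L), ← Real.mul_rpow two_pos.le hr.le,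
    Real.rpow_add (by positivity), mul_mul_mul_comm]

end
end

section
/- Let 0 < a < b < 1/2 and set K = C_a × C_b. Then 0 < 𝓗^{d_a + d_b}(K) < ∞, and for every Borel set E ⊂ ℝ², (μ_a × μ_b)(E) = 𝓗^{d_a + d_b}(K ∩ E)/𝓗^{d_a + d_b}(K). -/
open MeasureTheory Filter Metric Set Topology
open scoped ENNReal Topology

noncomputable section

/-- `C` is the attractor of the iterated function system `t ↦ ρ t`, `t ↦ ρ t + 1 - ρ`. -/
structure IsCantorAttractor (ρ : ℝ) (C : Set ℝ) : Prop where
  pos : 0 < ρ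
  lt_half : ρ < 1 / 2
  isCompact : IsCompact C
  nonempty : C.Nonempty
  eq_union : C = (fun t => ρ * t) '' C ∪ (fun t => ρ * t + 1 - ρ) '' C

/-- The homothetic copy `t + ρ ^ n • C` of `C`. -/
def cantorCylinder (ρ : ℝ) (C : Set ℝ) (n : ℕ) (t : ℝ) : Set ℝ := {x | (x - t) / ρ ^ n ∈ C}

/-- The positions of the level `n` copies of the attractor inside itself. -/
def shifts (ρ : ℝ) : ℕ → Finset ℝ
  | 0 => {0}
  | n + 1 => shifts ρ n ∪ (shifts ρ n).image (· + (1 - ρ) * ρ ^ n)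

theorem dd_pos_s16 {ρ : ℝ} (h0 : 0 < ρ) (h1 : ρ < 1) : 0 < dd ρ :=
  div_pos (Real.log_pos one_lt_two) (Real.log_pos (by rwa [lt_div_iff₀ h0, one_mul]))

theorem shifts_nonempty (ρ : ℝ) (n : ℕ) : (shifts ρ n).Nonempty := by
  induction n with
  | zero => simp [shifts]
  | succ n ih => exact ih.mono Finset.subset_union_left

theorem measurableSet_cylinder (ρ : ℝ) {C : Set ℝ} (hC : MeasurableSet C) (n : ℕ) (t : ℝ) :
    MeasurableSet (cantorCylinder ρ C n t) :=
  hC.preimage (by fun_prop : Measurable fun x : ℝ => (x - t) / ρ ^ n)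

theorem cantorCylinder_eq_preimage (ρ : ℝ) (C : Set ℝ) (n : ℕ) (t : ℝ) :
    cantorCylinder ρ C n t = (fun x => x + -t) ⁻¹' cantorCylinder ρ C n 0 := by
  ext x
  simp [cantorCylinder, sub_eq_add_neg]

namespace IsCantorAttractor

variable {ρ : ℝ} {C : Set ℝ}

theorem measurableSet (h : IsCantorAttractor ρ C) : MeasurableSet C :=
  h.isCompact.isClosed.measurableSet

theorem subset_Icc (h : IsCantorAttractor ρ C) : C ⊆ Icc 0 1 := by
  have h0 := h.pos
  have h1 := h.lt_half
  obtain ⟨m, hm, hmC⟩ := h.isCompact.exists_isLeast h.nonempty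
  obtain ⟨M, hM, hMC⟩ := h.isCompact.exists_isGreatest h.nonempty
  have hm0 : 0 ≤ m := by
    have h2 := hm
    rw [h.eq_union] at h2
    rcases h2 with ⟨t, ht, rfl⟩ | ⟨t, ht, rfl⟩ <;> have := hmC ht <;> simp only at * <;> nlinarith
  have hM1 : M ≤ 1 := by
    have h2 := hM
    rw [h.eq_union] at h2
    rcases h2 with ⟨t, ht, rfl⟩ | ⟨t, ht, rfl⟩ <;> have := hMC ht <;> simp only at * <;> nlinarith
  exact fun x hx => ⟨hm0.trans (hmC hx), (hMC hx).trans hM1⟩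

theorem mem_iff (h : IsCantorAttractor ρ C) (x : ℝ) :
    x ∈ C ↔ x / ρ ∈ C ∨ (x - (1 - ρ)) / ρ ∈ C := by
  have h0 := h.pos.ne'
  conv_lhs => rw [h.eq_union]
  refine or_congr ⟨?_, fun hx => ⟨_, hx, by field_simp⟩⟩ ⟨?_, fun hx => ⟨_, hx, by field_simp; ring⟩⟩
  · rintro ⟨t, ht, rfl⟩
    simpa [h0] using ht
  · rintro ⟨t, ht, rfl⟩
    convert ht using 1
    field_simp
    ring

theorem cylinder_eq_union (h : IsCantorAttractor ρ C) (n : ℕ) (t : ℝ) :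
    cantorCylinder ρ C n t =
      cantorCylinder ρ C (n + 1) t ∪ cantorCylinder ρ C (n + 1) (t + (1 - ρ) * ρ ^ n) := by
  have h0 := h.pos.ne'
  ext x
  simp only [cantorCylinder, mem_ofPred_eq, mem_union]
  rw [h.mem_iff]
  refine or_congr ?_ ?_
  · rw [div_div, pow_succ]
  · rw [show ((x - t) / ρ ^ n - (1 - ρ)) / ρ = (x - (t + (1 - ρ) * ρ ^ n)) / ρ ^ (n + 1) by
      field_simp; ring]

theorem biUnion_cylinder (h : IsCantorAttractor ρ C) (n : ℕ) :
    ⋃ t ∈ shifts ρ n, cantorCylinder ρ C n t = C := by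
  induction n with
  | zero => simp [shifts, cantorCylinder]
  | succ n ih =>
    simp only [shifts, Finset.set_biUnion_union, Finset.set_biUnion_finset_image]
    simp only [← iUnion_union_distrib]
    simpa only [← h.cylinder_eq_union n] using ih

theorem cylinder_subset (h : IsCantorAttractor ρ C) {n : ℕ} {t : ℝ} (ht : t ∈ shifts ρ n) :
    cantorCylinder ρ C n t ⊆ C :=
  (subset_biUnion_of_mem (u := cantorCylinder ρ C n) ht).trans (h.biUnion_cylinder n).subset

theorem cylinder_subset_Icc (h : IsCantorAttractor ρ C) (n : ℕ) (t : ℝ) :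
    cantorCylinder ρ C n t ⊆ Icc t (t + ρ ^ n) := by
  intro x hx
  have hn := pow_pos h.pos n
  have := h.subset_Icc hx
  rw [mem_Icc, le_div_iff₀ hn, div_le_iff₀ hn] at this
  constructor <;> linarith [this.1, this.2]

theorem gap_lt_abs_sub (h : IsCantorAttractor ρ C) {n : ℕ} {t u x y : ℝ} (ht : t ∈ shifts ρ n)
    (hu : u ∈ shifts ρ n) (htu : t ≠ u) (hx : x ∈ cantorCylinder ρ C n t)
    (hy : y ∈ cantorCylinder ρ C n u) :
    (1 - 2 * ρ) * ρ ^ n < |x - y| := by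
  have h0 := h.pos
  have h1 := h.lt_half
  induction n generalizing t u with
  | zero => simp_all [shifts]
  | succ n ih =>
    have hn := pow_pos h0 n
    have hlt : (1 - 2 * ρ) * ρ ^ (n + 1) < (1 - 2 * ρ) * ρ ^ n := by
      rw [pow_succ]
      exact mul_lt_mul_of_pos_left (by nlinarith) (by linarith)
    have hparent : ∀ {t x : ℝ}, t ∈ shifts ρ (n + 1) → x ∈ cantorCylinder ρ C (n + 1) t →
        ∃ s ∈ shifts ρ n, x ∈ cantorCylinder ρ C n s ∧ (t = s ∨ t = s + (1 - ρ) * ρ ^ n) := by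
      intro t x ht hx
      simp only [shifts, Finset.mem_union, Finset.mem_image] at ht
      rcases ht with ht | ⟨s, hs, rfl⟩
      · exact ⟨t, ht, by rw [h.cylinder_eq_union n]; exact .inl hx, .inl rfl⟩
      · exact ⟨s, hs, by rw [h.cylinder_eq_union n]; exact .inr hx, .inr rfl⟩
    obtain ⟨s, hs, hxs, hts⟩ := hparent ht hx
    obtain ⟨v, hv, hyv, huv⟩ := hparent hu hy
    by_cases hsv : s = v
    · subst hsv
      have hx' := h.cylinder_subset_Icc _ _ hx
      have hy' := h.cylinder_subset_Icc _ _ hy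
      refine hlt.trans_le ?_
      rw [pow_succ] at hx' hy'
      rcases hts with rfl | rfl <;> rcases huv with rfl | rfl
      · exact absurd rfl htu
      · rw [abs_sub_comm]
        exact le_trans (by nlinarith [hx'.2, hy'.1]) (le_abs_self _)
      · exact le_trans (by nlinarith [hx'.1, hy'.2]) (le_abs_self _)
      · exact absurd rfl htu
    · exact hlt.trans (ih hs hv hsv hxs hyv)

theorem pairwiseDisjoint_cylinder (h : IsCantorAttractor ρ C) (n : ℕ) :
    (shifts ρ n : Set ℝ).PairwiseDisjoint (cantorCylinder ρ C n) := by
  intro t ht u hu htu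
  refine disjoint_left.2 fun x hx hy => ?_
  have := h.gap_lt_abs_sub ht hu htu hx hy
  rw [sub_self, abs_zero] at this
  have hn := pow_pos h.pos n
  nlinarith [h.lt_half]

theorem measure_eq_card_mul (h : IsCantorAttractor ρ C) {ν : Measure ℝ} {n : ℕ} {c : ℝ≥0∞}
    (hc : ∀ t ∈ shifts ρ n, ν (cantorCylinder ρ C n t) = c) {F : Finset ℝ} (hF : F ⊆ shifts ρ n) :
    ν (⋃ t ∈ F, cantorCylinder ρ C n t) = F.card * c := by
  rw [measure_biUnion_finset ((h.pairwiseDisjoint_cylinder n).subset (by exact_mod_cast hF))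
    fun t _ => measurableSet_cylinder ρ h.measurableSet n t,
    Finset.sum_congr rfl fun t ht => hc t (hF ht), Finset.sum_const, nsmul_eq_mul]

theorem measure_Iic_le (h : IsCantorAttractor ρ C) {ν ν' : Measure ℝ} [IsFiniteMeasure ν']
    (hν : ν Cᶜ = 0) (hC : ν C = ν' C) {c c' : ℕ → ℝ≥0∞}
    (hc : ∀ n, ∀ t ∈ shifts ρ n, ν (cantorCylinder ρ C n t) = c n)
    (hc' : ∀ n, ∀ t ∈ shifts ρ n, ν' (cantorCylinder ρ C n t) = c' n) (x : ℝ) :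
    ν (Iic x) ≤ ν' (Iic x) := by
  classical
  have hcc (n : ℕ) : c n = c' n := by
    have h1 := h.measure_eq_card_mul (hc n) subset_rfl
    have h2 := h.measure_eq_card_mul (hc' n) subset_rfl
    rw [h.biUnion_cylinder] at h1 h2
    rw [h1, h2] at hC
    exact (ENNReal.mul_right_inj (by simpa using (shifts_nonempty ρ n).ne_empty) (by simp)).1 hC
  have hle (n : ℕ) : ν (Iic x) ≤ ν' (Iic (x + ρ ^ n)) := by
    set F := (shifts ρ n).filter fun t => t ≤ x with hF
    have hFs : F ⊆ shifts ρ n := Finset.filter_subset _ _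
    calc ν (Iic x) ≤ ν (Cᶜ ∪ ⋃ t ∈ F, cantorCylinder ρ C n t) := by
          refine measure_mono fun y hy => ?_
          by_cases hyC : y ∈ C
          · right
            rw [← h.biUnion_cylinder n] at hyC
            obtain ⟨t, ht, hyt⟩ := mem_iUnion₂.1 hyC
            exact mem_iUnion₂.2 ⟨t, Finset.mem_filter.2
              ⟨ht, (h.cylinder_subset_Icc n t hyt).1.trans hy⟩, hyt⟩
          · exact .inl hyC
      _ ≤ ν Cᶜ + ν (⋃ t ∈ F, cantorCylinder ρ C n t) := measure_union_le _ _
      _ = ν' (⋃ t ∈ F, cantorCylinder ρ C n t) := by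
          rw [hν, zero_add, h.measure_eq_card_mul (hc n) hFs, h.measure_eq_card_mul (hc' n) hFs,
            hcc]
      _ ≤ ν' (Iic (x + ρ ^ n)) := by
          refine measure_mono (iUnion₂_subset fun t ht y hy => ?_)
          have := (h.cylinder_subset_Icc n t hy).2
          have := (Finset.mem_filter.1 ht).2
          simp only [mem_Iic]
          linarith
  have hpow : Tendsto (fun n : ℕ => x + ρ ^ n) atTop (𝓝 x) := by
    simpa using (tendsto_pow_atTop_nhds_zero_of_lt_one h.pos.le
      (h.lt_half.trans one_half_lt_one)).const_add x
  have hInter : ⋂ n : ℕ, Iic (x + ρ ^ n) = Iic x := by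
    ext y
    simp only [mem_iInter, mem_Iic]
    exact ⟨fun hy => ge_of_tendsto' hpow hy,
      fun hy n => hy.trans (le_add_of_nonneg_right (pow_pos h.pos n).le)⟩
  have hlim : Tendsto (fun n : ℕ => ν' (Iic (x + ρ ^ n))) atTop (𝓝 (ν' (Iic x))) := by
    rw [← hInter]
    refine tendsto_measure_iInter_atTop (fun n => measurableSet_Iic.nullMeasurableSet) ?_
      ⟨0, measure_ne_top _ _⟩
    intro m n hmn
    exact Iic_subset_Iic.2 (add_le_add_right (pow_le_pow_of_le_one h.pos.le
      (h.lt_half.trans one_half_lt_one).le hmn) x)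
  exact ge_of_tendsto' hlim hle

theorem measure_ext (h : IsCantorAttractor ρ C) {ν ν' : Measure ℝ} [IsFiniteMeasure ν]
    [IsFiniteMeasure ν'] (hν : ν Cᶜ = 0) (hν' : ν' Cᶜ = 0) (hC : ν C = ν' C) {c c' : ℕ → ℝ≥0∞}
    (hc : ∀ n, ∀ t ∈ shifts ρ n, ν (cantorCylinder ρ C n t) = c n)
    (hc' : ∀ n, ∀ t ∈ shifts ρ n, ν' (cantorCylinder ρ C n t) = c' n) : ν = ν' :=
  Measure.ext_of_Iic _ _ fun x => le_antisymm (h.measure_Iic_le hν hC hc hc' x)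
    (h.measure_Iic_le hν' hC.symm hc' hc x)

open scoped Pointwise in
theorem hausdorffMeasure_cylinder (h : IsCantorAttractor ρ C) {d : ℝ} (hd : 0 ≤ d) (n : ℕ)
    (t : ℝ) : μH[d] (cantorCylinder ρ C n t) = ENNReal.ofReal (ρ ^ n) ^ d * μH[d] C := by
  have hn := pow_pos h.pos n
  have h0 : cantorCylinder ρ C n 0 = ρ ^ n • C := by
    ext x
    rw [mem_smul_set_iff_inv_smul_mem₀ hn.ne', cantorCylinder, mem_ofPred_eq, sub_zero, smul_eq_mul,
      div_eq_inv_mul]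
  rw [cantorCylinder_eq_preimage, measure_preimage_add_right, h0,
    Measure.hausdorffMeasure_smul₀ hd hn.ne', ENNReal.smul_def, smul_eq_mul,
    ENNReal.coe_rpow_of_nonneg _ hd]
  congr 3
  rw [← Real.toNNReal_eq_nnnorm_of_nonneg hn.le]

end IsCantorAttractor

/-- The Hausdorff measure of dimension `d` on `C`, normalised to have mass one. -/
def normalizedHausdorff (d : ℝ) (C : Set ℝ) : Measure ℝ := (μH[d] C)⁻¹ • μH[d].restrict C

theorem hausdorffMeasure_ne_zero_ne_top (d : ℝ) (C : Set ℝ)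
    [IsProbabilityMeasure (normalizedHausdorff d C)] : μH[d] C ≠ 0 ∧ μH[d] C ≠ ∞ := by
  have h := measure_univ (μ := normalizedHausdorff d C)
  rw [normalizedHausdorff, Measure.smul_apply, Measure.restrict_apply_univ, smul_eq_mul] at h
  constructor <;> intro h0 <;> simp [h0] at h

namespace IsCantorAttractor

variable {ρ d : ℝ} {C : Set ℝ}

theorem normalizedHausdorff_compl (h : IsCantorAttractor ρ C) (d : ℝ) :
    normalizedHausdorff d C Cᶜ = 0 := by
  simp [normalizedHausdorff, Measure.restrict_apply h.measurableSet.compl]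

theorem normalizedHausdorff_cylinder (h : IsCantorAttractor ρ C) (hd : 0 ≤ d)
    [IsProbabilityMeasure (normalizedHausdorff d C)] (n : ℕ) {t : ℝ} (ht : t ∈ shifts ρ n) :
    normalizedHausdorff d C (cantorCylinder ρ C n t) = ENNReal.ofReal (ρ ^ n) ^ d := by
  obtain ⟨h0, h1⟩ := hausdorffMeasure_ne_zero_ne_top d C
  rw [normalizedHausdorff, Measure.smul_apply,
    Measure.restrict_apply (measurableSet_cylinder ρ h.measurableSet n t),
    inter_eq_self_of_subset_left (h.cylinder_subset ht), h.hausdorffMeasure_cylinder hd,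
    smul_eq_mul, mul_left_comm, ENNReal.inv_mul_cancel h0 h1, mul_one]

theorem normalizedHausdorff_self (h : IsCantorAttractor ρ C)
    [IsProbabilityMeasure (normalizedHausdorff d C)] : normalizedHausdorff d C C = 1 := by
  rw [← measure_univ (μ := normalizedHausdorff d C)]
  exact measure_congr (ae_eq_univ.2 (h.normalizedHausdorff_compl d))

theorem card_shifts_mul (h : IsCantorAttractor ρ C) (hd : 0 ≤ d)
    [IsProbabilityMeasure (normalizedHausdorff d C)] (n : ℕ) :
    ((shifts ρ n).card : ℝ≥0∞) * ENNReal.ofReal (ρ ^ n) ^ d = 1 := by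
  rw [← h.measure_eq_card_mul (fun t ht => h.normalizedHausdorff_cylinder hd n ht) subset_rfl,
    h.biUnion_cylinder, h.normalizedHausdorff_self]

theorem normalizedHausdorff_le_of_forall_abs_sub_le (h : IsCantorAttractor ρ C) (hd : 0 ≤ d)
    [IsProbabilityMeasure (normalizedHausdorff d C)] {n : ℕ} {U : Set ℝ}
    (hU : ∀ x ∈ U, ∀ y ∈ U, |x - y| ≤ (1 - 2 * ρ) * ρ ^ n) :
    normalizedHausdorff d C U ≤ ENNReal.ofReal (ρ ^ n) ^ d := by
  have hUC : normalizedHausdorff d C U ≤ normalizedHausdorff d C (U ∩ C) := by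
    calc normalizedHausdorff d C U ≤ normalizedHausdorff d C (U ∩ C ∪ Cᶜ) :=
          measure_mono fun x hx => (em (x ∈ C)).imp (⟨hx, ·⟩) id
      _ ≤ _ := measure_union_le _ _
      _ = _ := by rw [h.normalizedHausdorff_compl, add_zero]
  refine hUC.trans ?_
  rcases (U ∩ C).eq_empty_or_nonempty with he | ⟨x, hxU, hxC⟩
  · simp [he]
  rw [← h.biUnion_cylinder n] at hxC
  obtain ⟨t, ht, hxt⟩ := mem_iUnion₂.1 hxC
  rw [← h.normalizedHausdorff_cylinder hd n ht]
  refine measure_mono fun y hy => ?_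
  have hyC := hy.2
  rw [← h.biUnion_cylinder n] at hyC
  obtain ⟨u, hu, hyu⟩ := mem_iUnion₂.1 hyC
  by_cases htu : t = u
  · rwa [htu]
  · exact absurd (hU x hxU y hy.1) (h.gap_lt_abs_sub ht hu htu hxt hyu).not_ge

theorem exists_normalizedHausdorff_le (h : IsCantorAttractor ρ C) (hd : 0 < d)
    [IsProbabilityMeasure (normalizedHausdorff d C)] :
    ∃ K : ℝ≥0∞, K ≠ 0 ∧ K ≠ ∞ ∧ ∀ U : Set ℝ, normalizedHausdorff d C U ≤ K * ediam U ^ d := by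
  have h0 := h.pos
  have h1 : 0 < 1 - 2 * ρ := by linarith [h.lt_half]
  have hg : 0 < (1 - 2 * ρ) * ρ := mul_pos h1 h0
  set K : ℝ≥0∞ := ENNReal.ofReal ((1 - 2 * ρ) * ρ)⁻¹ ^ d with hK
  have hK0 : K ≠ 0 :=
    (ENNReal.rpow_pos (ENNReal.ofReal_pos.2 (inv_pos.2 hg)) ENNReal.ofReal_ne_top).ne'
  refine ⟨K, hK0, ENNReal.rpow_ne_top_of_nonneg hd.le ENNReal.ofReal_ne_top, fun U => ?_⟩
  by_cases hT : ediam U = ∞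
  · simp [hT, hd, ENNReal.mul_top hK0]
  by_cases hZ : ediam U = 0
  · rw [ediam_eq_zero_iff] at hZ
    have := Measure.nullSingletonClass_hausdorff ℝ hd
    rw [normalizedHausdorff, Measure.smul_apply, hZ.measure_zero, smul_zero]
    exact zero_le
  set r := (ediam U).toReal with hr
  have hr0 : 0 < r := ENNReal.toReal_pos hZ hT
  have hUr : ∀ x ∈ U, ∀ y ∈ U, |x - y| ≤ r := by
    intro x hx y hy
    rw [← Real.dist_eq, dist_edist]
    exact ENNReal.toReal_mono hT (edist_le_ediam_of_mem hx hy)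
  rw [← ENNReal.ofReal_toReal hT, ← hr, hK, ← ENNReal.mul_rpow_of_nonneg _ _ hd.le,
    ← ENNReal.ofReal_mul (inv_pos.2 hg).le]
  rcases le_or_gt (1 - 2 * ρ) r with hrg | hrg
  · refine prob_le_one.trans (ENNReal.one_le_rpow (ENNReal.one_le_ofReal.2 ?_) hd)
    rw [← div_eq_inv_mul, one_le_div hg]
    nlinarith [h.lt_half]
  · obtain ⟨n, hn, hn'⟩ := exists_nat_pow_near_of_lt_one (div_pos hr0 h1)
      ((div_le_one h1).2 hrg.le) h0 (h.lt_half.trans one_half_lt_one)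
    rw [div_le_iff₀ h1] at hn'
    rw [lt_div_iff₀ h1] at hn
    refine (h.normalizedHausdorff_le_of_forall_abs_sub_le hd.le
      fun x hx y hy => (hUr x hx y hy).trans (hn'.trans_eq (mul_comm _ _))).trans ?_
    refine ENNReal.rpow_le_rpow (ENNReal.ofReal_le_ofReal ?_) hd.le
    rw [← div_eq_inv_mul, le_div_iff₀ hg]
    calc _ = ρ ^ (n + 1) * (1 - 2 * ρ) := by ring
      _ ≤ r := hn.le

end IsCantorAttractor

theorem emb_add (p q : ℝ × ℝ) : emb (p + q) = emb p + emb q := by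
  ext i
  fin_cases i <;> simp [emb]

theorem dist_emb (p q : ℝ × ℝ) :
    dist (emb p) (emb q) = √((p.1 - q.1) ^ 2 + (p.2 - q.2) ^ 2) := by
  rw [EuclideanSpace.dist_eq]
  simp [emb, Fin.sum_univ_two, Real.dist_eq]

theorem abs_fst_sub_le_dist_emb (p q : ℝ × ℝ) : |p.1 - q.1| ≤ dist (emb p) (emb q) := by
  rw [dist_emb]
  exact Real.abs_le_sqrt (by nlinarith [sq_nonneg (p.2 - q.2)])

theorem abs_snd_sub_le_dist_emb (p q : ℝ × ℝ) : |p.2 - q.2| ≤ dist (emb p) (emb q) := by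
  rw [dist_emb]
  exact Real.abs_le_sqrt (by nlinarith [sq_nonneg (p.1 - q.1)])

theorem dist_emb_le (p q : ℝ × ℝ) : dist (emb p) (emb q) ≤ |p.1 - q.1| + |p.2 - q.2| := by
  rw [dist_emb]
  refine Real.sqrt_le_iff.2 ⟨by positivity, ?_⟩
  rw [← sq_abs (p.1 - q.1), ← sq_abs (p.2 - q.2)]
  nlinarith [mul_nonneg (abs_nonneg (p.1 - q.1)) (abs_nonneg (p.2 - q.2))]

theorem measurableEmbedding_emb : MeasurableEmbedding emb := by
  refine Continuous.measurableEmbedding ?_ fun p q hpq => ?_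
  · refine LipschitzWith.continuous (K := 2) (LipschitzWith.of_dist_le_mul fun p q => ?_)
    refine (dist_emb_le p q).trans ?_
    have h1 : |p.1 - q.1| ≤ dist p q := le_max_left _ _
    have h2 : |p.2 - q.2| ≤ dist p q := le_max_right _ _
    push_cast
    linarith
  · have h0 : dist (emb p) (emb q) = 0 := by rw [hpq, dist_self]
    have h1 := (abs_fst_sub_le_dist_emb p q).trans_eq h0
    have h2 := (abs_snd_sub_le_dist_emb p q).trans_eq h0
    exact Prod.ext (sub_eq_zero.1 (abs_nonpos_iff.1 h1)) (sub_eq_zero.1 (abs_nonpos_iff.1 h2))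

theorem ediam_image_fst_le (U : Set (Euc 2)) : ediam (Prod.fst '' (emb ⁻¹' U)) ≤ ediam U := by
  refine ediam_le ?_
  rintro _ ⟨p, hp, rfl⟩ _ ⟨q, hq, rfl⟩
  refine le_trans ?_ (edist_le_ediam_of_mem hp hq)
  rw [edist_dist, edist_dist]
  exact ENNReal.ofReal_le_ofReal (abs_fst_sub_le_dist_emb p q)

theorem ediam_image_snd_le (U : Set (Euc 2)) : ediam (Prod.snd '' (emb ⁻¹' U)) ≤ ediam U := by
  refine ediam_le ?_
  rintro _ ⟨p, hp, rfl⟩ _ ⟨q, hq, rfl⟩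
  refine le_trans ?_ (edist_le_ediam_of_mem hp hq)
  rw [edist_dist, edist_dist]
  exact ENNReal.ofReal_le_ofReal (abs_snd_sub_le_dist_emb p q)

theorem comap_emb_hausdorffMeasure_preimage_add (d : ℝ) (v : ℝ × ℝ) (S : Set (ℝ × ℝ)) :
    Measure.comap emb μH[d] ((fun p => p + v) ⁻¹' S) = Measure.comap emb μH[d] S := by
  rw [measurableEmbedding_emb.comap_apply, measurableEmbedding_emb.comap_apply,
    ← measure_preimage_add_right μH[d] (emb v) (emb '' S)]
  congr 1
  ext x
  constructor
  · rintro ⟨p, hp, rfl⟩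
    exact ⟨p + v, hp, emb_add p v⟩
  · rintro ⟨p, hp, hpx⟩
    refine ⟨p - v, by simpa using hp, ?_⟩
    rw [← add_left_inj (emb v), ← emb_add, sub_add_cancel, hpx]

section Product

variable {a b d e : ℝ} {A B : Set ℝ}

theorem hausdorffMeasure_emb_image_pos (hA : IsCantorAttractor a A) (hB : IsCantorAttractor b B)
    (hd : 0 < d) (he : 0 < e) [IsProbabilityMeasure (normalizedHausdorff d A)]
    [IsProbabilityMeasure (normalizedHausdorff e B)] : 0 < μH[d + e] (emb '' (A ×ˢ B)) := by
  obtain ⟨K, hK0, hK, hKA⟩ := hA.exists_normalizedHausdorff_le hd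
  obtain ⟨L, hL0, hL, hLB⟩ := hB.exists_normalizedHausdorff_le he
  have hKL0 : K * L ≠ 0 := mul_ne_zero hK0 hL0
  have hKL : K * L ≠ ∞ := ENNReal.mul_ne_top hK hL
  have hle : (K * L)⁻¹ • Measure.map emb ((normalizedHausdorff d A).prod (normalizedHausdorff e B))
      ≤ μH[d + e] := by
    refine Measure.le_hausdorffMeasure _ _ 1 one_pos fun U _ => ?_
    rw [Measure.smul_apply, smul_eq_mul, measurableEmbedding_emb.map_apply,
      ENNReal.inv_mul_le_iff hKL0 hKL]
    calc _ ≤ (normalizedHausdorff d A).prod (normalizedHausdorff e B)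
          ((Prod.fst '' (emb ⁻¹' U)) ×ˢ (Prod.snd '' (emb ⁻¹' U))) :=
          measure_mono fun p hp => ⟨mem_image_of_mem _ hp, mem_image_of_mem _ hp⟩
      _ ≤ (K * ediam U ^ d) * (L * ediam U ^ e) := by
          rw [Measure.prod_prod]
          gcongr
          · exact (hKA _).trans (by gcongr; exact ediam_image_fst_le U)
          · exact (hLB _).trans (by gcongr; exact ediam_image_snd_le U)
      _ = K * L * ediam U ^ (d + e) := by
          rw [ENNReal.rpow_add_of_nonneg _ _ hd.le he.le]
          ring
  refine lt_of_lt_of_le ?_ (hle (emb '' (A ×ˢ B)))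
  rw [Measure.smul_apply, smul_eq_mul, measurableEmbedding_emb.map_apply,
    preimage_image_eq _ measurableEmbedding_emb.injective, Measure.prod_prod,
    hA.normalizedHausdorff_self, hB.normalizedHausdorff_self, one_mul, mul_one]
  exact ENNReal.inv_pos.2 hKL

theorem ediam_emb_image_cylinder_prod_le (hA : IsCantorAttractor a A) (hB : IsCantorAttractor b B)
    (n m : ℕ) (t u : ℝ) :
    ediam (emb '' (cantorCylinder a A n t ×ˢ cantorCylinder b B m u))
      ≤ ENNReal.ofReal (a ^ n + b ^ m) := by
  refine ediam_le ?_
  rintro _ ⟨p, hp, rfl⟩ _ ⟨q, hq, rfl⟩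
  rw [edist_dist]
  refine ENNReal.ofReal_le_ofReal ((dist_emb_le p q).trans (add_le_add ?_ ?_)) <;>
    rw [abs_sub_le_iff]
  · have hp1 := hA.cylinder_subset_Icc n t hp.1
    have hq1 := hA.cylinder_subset_Icc n t hq.1
    constructor <;> linarith [hp1.1, hp1.2, hq1.1, hq1.2]
  · have hp2 := hB.cylinder_subset_Icc m u hp.2
    have hq2 := hB.cylinder_subset_Icc m u hq.2
    constructor <;> linarith [hp2.1, hp2.2, hq2.1, hq2.2]

theorem hausdorffMeasure_emb_image_lt_top (hA : IsCantorAttractor a A)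
    (hB : IsCantorAttractor b B) (hd : 0 < d) (he : 0 < e)
    [IsProbabilityMeasure (normalizedHausdorff d A)]
    [IsProbabilityMeasure (normalizedHausdorff e B)] : μH[d + e] (emb '' (A ×ˢ B)) < ∞ := by
  have ha := hA.pos
  have ha1 := hA.lt_half.trans one_half_lt_one
  have hb := hB.pos
  have hb1 := hB.lt_half.trans one_half_lt_one
  have hm (n : ℕ) : ∃ m : ℕ, b ^ (m + 1) < a ^ n ∧ a ^ n ≤ b ^ m :=
    exists_nat_pow_near_of_lt_one (pow_pos ha n) (pow_le_one₀ ha.le ha1.le) hb hb1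
  choose m hm hm' using hm
  have hbm (n : ℕ) : b ^ m n ≤ b⁻¹ * a ^ n := by
    rw [le_inv_mul_iff₀ hb, ← pow_succ']
    exact (hm n).le
  have hd2 : 0 ≤ d + e := (add_pos hd he).le
  have hdiam (n : ℕ) (i : shifts a n × shifts b (m n)) :
      ediam (emb '' (cantorCylinder a A n i.1 ×ˢ cantorCylinder b B (m n) i.2))
        ≤ ENNReal.ofReal (2 * b⁻¹) * ENNReal.ofReal (a ^ n) := by
    rw [← ENNReal.ofReal_mul (by positivity)]
    refine (ediam_emb_image_cylinder_prod_le hA hB _ _ _ _).trans (ENNReal.ofReal_le_ofReal ?_)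
    linarith [hbm n, hm' n]
  have hsum (n : ℕ) : ∑ i : shifts a n × shifts b (m n),
      ediam (emb '' (cantorCylinder a A n i.1 ×ˢ cantorCylinder b B (m n) i.2)) ^ (d + e)
        ≤ ENNReal.ofReal (2 * b⁻¹) ^ (d + e) := by
    calc _ ≤ ∑ _i : shifts a n × shifts b (m n),
          (ENNReal.ofReal (2 * b⁻¹) * ENNReal.ofReal (a ^ n)) ^ (d + e) :=
          Finset.sum_le_sum fun i _ => ENNReal.rpow_le_rpow (hdiam n i) hd2
      _ = ENNReal.ofReal (2 * b⁻¹) ^ (d + e) *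
          (((shifts a n).card * ENNReal.ofReal (a ^ n) ^ d) *
            ((shifts b (m n)).card * ENNReal.ofReal (a ^ n) ^ e)) := by
          rw [Finset.sum_const, Finset.card_univ, Fintype.card_prod, Fintype.card_coe,
            Fintype.card_coe, nsmul_eq_mul, ENNReal.mul_rpow_of_nonneg _ _ hd2,
            ENNReal.rpow_add_of_nonneg (x := ENNReal.ofReal (a ^ n)) _ _ hd.le he.le]
          push_cast
          ring
      _ ≤ ENNReal.ofReal (2 * b⁻¹) ^ (d + e) *
          (((shifts a n).card * ENNReal.ofReal (a ^ n) ^ d) *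
            ((shifts b (m n)).card * ENNReal.ofReal (b ^ m n) ^ e)) := by
          gcongr
          exact hm' n
      _ = _ := by rw [hA.card_shifts_mul hd.le, hB.card_shifts_mul he.le, mul_one, mul_one]
  have hlim : Tendsto (fun n : ℕ => ENNReal.ofReal (2 * b⁻¹) * ENNReal.ofReal (a ^ n)) atTop
      (𝓝 0) := by
    have := (ENNReal.tendsto_ofReal (tendsto_pow_atTop_nhds_zero_of_lt_one ha.le ha1))
    rw [ENNReal.ofReal_zero] at this
    simpa only [mul_zero] using ENNReal.Tendsto.const_mul this (.inr ENNReal.ofReal_ne_top)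
  have hcover (n : ℕ) : emb '' (A ×ˢ B) ⊆ ⋃ i : shifts a n × shifts b (m n),
      emb '' (cantorCylinder a A n i.1 ×ˢ cantorCylinder b B (m n) i.2) := by
    rintro _ ⟨⟨x, y⟩, ⟨hx, hy⟩, rfl⟩
    rw [← hA.biUnion_cylinder n] at hx
    rw [← hB.biUnion_cylinder (m n)] at hy
    obtain ⟨t, ht, hxt⟩ := mem_iUnion₂.1 hx
    obtain ⟨u, hu, hyu⟩ := mem_iUnion₂.1 hy
    exact mem_iUnion.2 ⟨(⟨t, ht⟩, ⟨u, hu⟩), mem_image_of_mem _ ⟨hxt, hyu⟩⟩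
  refine (Measure.hausdorffMeasure_le_liminf_sum (d + e) _ _ hlim _
    (Eventually.of_forall hdiam) (Eventually.of_forall hcover)).trans_lt ?_
  refine (liminf_le_of_le (by isBoundedDefault) fun c hc => ?_).trans_lt
    (ENNReal.rpow_lt_top_of_nonneg hd2 ENNReal.ofReal_ne_top :
      ENNReal.ofReal (2 * b⁻¹) ^ (d + e) < ∞)
  obtain ⟨n, hn⟩ := hc.exists
  exact hn.trans (hsum n)

theorem comap_emb_hausdorffMeasure_restrict_eq (hA : IsCantorAttractor a A)
    (hB : IsCantorAttractor b B) (hd : 0 < d) (he : 0 < e)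
    [IsProbabilityMeasure (normalizedHausdorff d A)]
    [IsProbabilityMeasure (normalizedHausdorff e B)] (s : ℝ)
    (hs : μH[s] (emb '' (A ×ˢ B)) ≠ ∞) :
    (Measure.comap emb μH[s]).restrict (A ×ˢ B) = μH[s] (emb '' (A ×ˢ B)) •
      (normalizedHausdorff d A).prod (normalizedHausdorff e B) := by
  have hAm := hA.measurableSet
  have hBm := hB.measurableSet
  set G : Measure (ℝ × ℝ) := Measure.comap emb μH[s]
  set κ := μH[s] (emb '' (A ×ˢ B))
  have hG : G (A ×ˢ B) = κ := measurableEmbedding_emb.comap_apply _ _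
  have hGv (v : ℝ × ℝ) (S : Set (ℝ × ℝ)) : G ((fun p => p + v) ⁻¹' S) = G S :=
    comap_emb_hausdorffMeasure_preimage_add s v S
  have : IsFiniteMeasure (G.restrict (A ×ˢ B)) :=
    ⟨by rw [Measure.restrict_apply_univ, hG]; exact hs.lt_top⟩
  have hfst : (G.restrict (A ×ˢ B)).fst = κ • normalizedHausdorff d A := by
    have : IsFiniteMeasure (κ • normalizedHausdorff d A) :=
      Measure.smul_finite _ hs
    have happ {S : Set ℝ} (hS : MeasurableSet S) :
        (G.restrict (A ×ˢ B)).fst S = G ((S ∩ A) ×ˢ B) := by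
      rw [Measure.fst_apply hS, Measure.restrict_apply (measurable_fst hS), ← prod_univ,
        prod_inter_prod, univ_inter]
    refine hA.measure_ext (c := fun n => G (cantorCylinder a A n 0 ×ˢ B))
      (c' := fun n => κ * ENNReal.ofReal (a ^ n) ^ d) ?_ ?_ ?_ ?_ ?_
    · rw [happ hAm.compl]
      simp
    · simp [hA.normalizedHausdorff_compl]
    · rw [happ hAm, inter_self, hG, Measure.smul_apply, hA.normalizedHausdorff_self, smul_eq_mul,
        mul_one]
    · intro n t ht
      rw [happ (measurableSet_cylinder a hAm n t),
        inter_eq_self_of_subset_left (hA.cylinder_subset ht),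
        ← hGv (-t, 0) (cantorCylinder a A n 0 ×ˢ B)]
      congr 1
      ext p
      simp [cantorCylinder_eq_preimage a A n t]
    · intro n t ht
      rw [Measure.smul_apply, hA.normalizedHausdorff_cylinder hd.le n ht, smul_eq_mul]
  have hsnd {S : Set ℝ} (hS : MeasurableSet S) :
      ((G.restrict (A ×ˢ B)).restrict (S ×ˢ univ)).snd
        = G ((S ∩ A) ×ˢ B) • normalizedHausdorff e B := by
    have hfin : G ((S ∩ A) ×ˢ B) ≠ ∞ :=
      ((measure_mono (prod_mono_left inter_subset_right)).trans_lt (hG.trans_lt hs.lt_top)).ne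
    have : IsFiniteMeasure (G ((S ∩ A) ×ˢ B) • normalizedHausdorff e B) :=
      Measure.smul_finite _ hfin
    have happ {T : Set ℝ} (hT : MeasurableSet T) :
        ((G.restrict (A ×ˢ B)).restrict (S ×ˢ univ)).snd T = G ((S ∩ A) ×ˢ (T ∩ B)) := by
      rw [Measure.snd_apply hT, Measure.restrict_apply (measurable_snd hT), ← univ_prod,
        prod_inter_prod, univ_inter, inter_univ, Measure.restrict_apply (hS.prod hT),
        prod_inter_prod]
    refine hB.measure_ext (c := fun n => G ((S ∩ A) ×ˢ cantorCylinder b B n 0))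
      (c' := fun n => G ((S ∩ A) ×ˢ B) * ENNReal.ofReal (b ^ n) ^ e) ?_ ?_ ?_ ?_ ?_
    · rw [happ hBm.compl]
      simp
    · simp [hB.normalizedHausdorff_compl]
    · rw [happ hBm, inter_self, Measure.smul_apply, hB.normalizedHausdorff_self, smul_eq_mul,
        mul_one]
    · intro n t ht
      rw [happ (measurableSet_cylinder b hBm n t),
        inter_eq_self_of_subset_left (hB.cylinder_subset ht),
        ← hGv (0, -t) ((S ∩ A) ×ˢ cantorCylinder b B n 0)]
      congr 1
      ext p
      simp [cantorCylinder_eq_preimage b B n t]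
    · intro n t ht
      rw [Measure.smul_apply, hB.normalizedHausdorff_cylinder he.le n ht, smul_eq_mul]
  have : IsFiniteMeasure (κ • normalizedHausdorff d A) := Measure.smul_finite _ hs
  rw [← Measure.prod_smul_left]
  refine (Measure.prod_eq fun S T hS hT => ?_).symm
  rw [← hfst, Measure.fst_apply hS, ← prod_univ, Measure.restrict_apply (hS.prod .univ),
    prod_inter_prod, univ_inter]
  have := congrArg (fun ν => ν T) (hsnd hS)
  rw [Measure.snd_apply hT, Measure.restrict_apply (measurable_snd hT), ← univ_prod,
    prod_inter_prod, univ_inter, inter_univ] at this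
  simpa using this

end Product

theorem statement16
    (a b : ℝ) (ha : 0 < a) (hab : a < b) (hb : b < 1 / 2)
    (Ca Cb : Set ℝ)
    (hCacomp : IsCompact Ca) (hCane : Ca.Nonempty)
    (hCaattr : Ca = (fun t => a * t) '' Ca ∪ (fun t => a * t + 1 - a) '' Ca)
    (hCbcomp : IsCompact Cb) (hCbne : Cb.Nonempty)
    (hCbattr : Cb = (fun t => b * t) '' Cb ∪ (fun t => b * t + 1 - b) '' Cb)
    (μa μb : Measure ℝ) [IsProbabilityMeasure μa] [IsProbabilityMeasure μb]
    (hμa : μa = (μH[dd a] Ca)⁻¹ • μH[dd a].restrict Ca)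
    (hμb : μb = (μH[dd b] Cb)⁻¹ • μH[dd b].restrict Cb)
 :
    0 < μH[dd a + dd b] (emb '' (Ca ×ˢ Cb)) ∧
      μH[dd a + dd b] (emb '' (Ca ×ˢ Cb)) < ⊤ ∧
      ∀ E : Set (Euc 2), MeasurableSet E →
        (Measure.map emb (μa.prod μb)) E
          = μH[dd a + dd b] ((emb '' (Ca ×ˢ Cb)) ∩ E) / μH[dd a + dd b] (emb '' (Ca ×ˢ Cb)) := by
  have hd : 0 < dd a := dd_pos_s16 ha (by linarith)
  have he : 0 < dd b := dd_pos_s16 (ha.trans hab) (by linarith)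
  have hA : IsCantorAttractor a Ca := ⟨ha, hab.trans hb, hCacomp, hCane, hCaattr⟩
  have hB : IsCantorAttractor b Cb := ⟨ha.trans hab, hb, hCbcomp, hCbne, hCbattr⟩
  change μa = normalizedHausdorff (dd a) Ca at hμa
  change μb = normalizedHausdorff (dd b) Cb at hμb
  subst hμa hμb
  have hpos := hausdorffMeasure_emb_image_pos hA hB hd he
  have hfin := hausdorffMeasure_emb_image_lt_top hA hB hd he
  refine ⟨hpos, hfin, fun E hE => ?_⟩
  rw [ENNReal.eq_div_iff hpos.ne' hfin.ne, measurableEmbedding_emb.map_apply, ← smul_eq_mul,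
    ← Measure.smul_apply, ← comap_emb_hausdorffMeasure_restrict_eq hA hB hd he _ hfin.ne,
    Measure.restrict_apply (measurableEmbedding_emb.measurable hE),
    measurableEmbedding_emb.comap_apply, inter_comm, image_inter_preimage]

end
end
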